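/- Fix a positive integer m and a binary string x ∈ {0,1}^m. Then as n → ∞, the fourth central moment satisfies E[(Ω_n(x) − E[Ω_n(x)])⁴] = O(n^{4m−2}), and the third central moment satisfies E[(Ω_n(x) − E[Ω_n(x)])³] = o(n^{3m−3/2}). -/

import Mathlib

open Filter Asymptotics

/-- `ω_x(y)`: the number of ways the string `x` of length `m` can be embedded as a
subsequence of the string `y` of length `n`, i.e. the number of strictly increasing
index maps `π : Fin m → Fin n` with `y ∘ π = x`. -/
noncomputable def omega {m n : ℕ} (x : Fin m → Bool) (y : Fin n → Bool) : ℕ :=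
  Nat.card {π : Fin m → Fin n // StrictMono π ∧ ∀ j, y (π j) = x j}

/-- Expectation of `f` under the uniform distribution on `{0,1}^n`. -/
noncomputable def expectUnif (n : ℕ) (f : (Fin n → Bool) → ℝ) : ℝ :=
  (∑ y : Fin n → Bool, f y) / 2 ^ n

/-- Variance of `f` under the uniform distribution on `{0,1}^n`. -/
noncomputable def varUnif (n : ℕ) (f : (Fin n → Bool) → ℝ) : ℝ :=
  expectUnif n (fun y => (f y - expectUnif n f) ^ 2)

open Finset

lemma expectUnif_add (n : ℕ) (f g : (Fin n → Bool) → ℝ) :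
    expectUnif n (fun y => f y + g y) = expectUnif n f + expectUnif n g := by
  simp only [expectUnif, sum_add_distrib, add_div]

lemma expectUnif_const (n : ℕ) (c : ℝ) : expectUnif n (fun _ => c) = c := by
  simp [expectUnif]

lemma expectUnif_sum {ι : Type*} (n : ℕ) (s : Finset ι) (f : ι → (Fin n → Bool) → ℝ) :
    expectUnif n (fun y => ∑ i ∈ s, f i y) = ∑ i ∈ s, expectUnif n (f i) := by
  simp only [expectUnif]
  rw [sum_comm, sum_div]

lemma expectUnif_mono (n : ℕ) {f g : (Fin n → Bool) → ℝ} (h : ∀ y, f y ≤ g y) :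
    expectUnif n f ≤ expectUnif n g := by
  unfold expectUnif
  gcongr with y
  exact h y

lemma abs_expectUnif_le (n : ℕ) {f : (Fin n → Bool) → ℝ} {c : ℝ} (h : ∀ y, |f y| ≤ c) :
    |expectUnif n f| ≤ c := by
  rw [abs_le]
  constructor
  · rw [← expectUnif_const n (-c)]
    exact expectUnif_mono n fun y => (abs_le.1 (h y)).1
  · rw [← expectUnif_const n c]
    exact expectUnif_mono n fun y => (abs_le.1 (h y)).2

/-- Functions of disjoint sets of coordinates are uncorrelated under the uniform distribution. -/
lemma expectUnif_mul_of_dependsOn {n : ℕ} {f g : (Fin n → Bool) → ℝ} {s : Set (Fin n)}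
    (hf : DependsOn f s) (hg : DependsOn g sᶜ) :
    expectUnif n (fun y => f y * g y) = expectUnif n f * expectUnif n g := by
  classical
  let swap : (Fin n → Bool) × (Fin n → Bool) → (Fin n → Bool) × (Fin n → Bool) :=
    fun z => (s.piecewise z.1 z.2, s.piecewise z.2 z.1)
  have hswap : Function.Involutive swap := by
    rintro ⟨a, b⟩
    ext i <;> by_cases hi : i ∈ s <;> simp [swap, hi]
  have key : (∑ y, f y) * ∑ y, g y = 2 ^ n * ∑ y, f y * g y := by
    calc (∑ y, f y) * ∑ y, g y
        = ∑ z : (Fin n → Bool) × (Fin n → Bool), f z.1 * g z.2 := by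
          rw [sum_mul_sum, Fintype.sum_prod_type]
      _ = ∑ z : (Fin n → Bool) × (Fin n → Bool), f (swap z).1 * g (swap z).2 :=
          (Equiv.sum_comp hswap.toPerm fun z => f z.1 * g z.2).symm
      _ = ∑ z : (Fin n → Bool) × (Fin n → Bool), f z.1 * g z.1 := by
          refine sum_congr rfl fun z _ => ?_
          congr 1
          · exact hf fun i hi => by simp [swap, hi]
          · exact hg fun i hi => by
              have hi' : i ∉ s := hi
              simp [swap, hi']
      _ = 2 ^ n * ∑ y, f y * g y := by
          simp [Fintype.sum_prod_type, mul_sum]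
  unfold expectUnif
  rw [div_mul_div_comm, key, mul_div_mul_left _ _ (by positivity)]

/-- Two independent coincidence constraints cost two degrees of freedom. -/
lemma card_filter_eq_and_eq_le {ι α : Type*} [Fintype ι] [DecidableEq ι] [Fintype α]
    [DecidableEq α] {p q r s : ι} (hpq : p ≠ q) (hrs : r ≠ s) (hpr : p ≠ r) (hps : p ≠ s) :
    #{F : ι → α | F p = F q ∧ F r = F s} ≤ Fintype.card α ^ (Fintype.card ι - 2) := by
  have hcard : Fintype.card {i // i ∉ ({p, r} : Finset ι)} = Fintype.card ι - 2 := by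
    rw [Fintype.card_subtype_compl, Fintype.card_coe, card_pair hpr]
  rw [← hcard, ← Fintype.card_fun, ← Finset.card_univ]
  refine card_le_card_of_injOn (fun F i => F i) (fun _ _ => by simp) ?_
  intro F hF G hG hFG
  simp only [coe_filter, mem_univ, true_and, Set.mem_ofPred_eq] at hF hG
  have off : ∀ i, i ≠ p → i ≠ r → F i = G i := fun i hp hr =>
    congrFun hFG ⟨i, by simp [hp, hr]⟩
  have at_r : F r = G r := by rw [hF.2, hG.2, off s hps.symm hrs.symm]
  have off_p : ∀ i, i ≠ p → F i = G i := fun i hp => by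
    by_cases hr : i = r
    · rw [hr, at_r]
    · exact off i hp hr
  ext i
  by_cases hp : i = p
  · rw [hp, hF.1, hG.1, off_p q hpq.symm]
  · exact off_p i hp

/-- Families of `K ≥ 3` index maps in which every map meets another one. -/
def Entangled {K m n : ℕ} (F : Fin K × Fin m → Fin n) : Prop :=
  ∀ i, ∃ j, j ≠ i ∧ ∃ a b, F (i, a) = F (j, b)

open Classical in
lemma card_entangled_le {K : ℕ} (hK : 3 ≤ K) (m n : ℕ) :
    #{F : Fin K × Fin m → Fin n | Entangled F} ≤ (K * m) ^ 4 * n ^ (K * m - 2) := by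
  let I := Fin K × Fin m
  let good : Finset (I × I × I × I) :=
    {t | t.1 ≠ t.2.1 ∧ t.2.2.1 ≠ t.2.2.2 ∧ t.1 ≠ t.2.2.1 ∧ t.1 ≠ t.2.2.2}
  have hsub : ({F : I → Fin n | Entangled F} : Finset _) ⊆
      good.biUnion fun t => {F | F t.1 = F t.2.1 ∧ F t.2.2.1 = F t.2.2.2} := by
    intro F hF
    have hF : Entangled F := by simpa using hF
    let i₀ : Fin K := ⟨0, by lia⟩
    obtain ⟨j, hj, c, d, hcd⟩ := hF i₀
    obtain ⟨k, hk⟩ : ∃ k, k ∉ ({i₀, j} : Finset (Fin K)) := by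
      by_contra! h
      have hle := (card_le_card fun k (_ : k ∈ univ) => h k).trans card_le_two
      rw [card_univ, Fintype.card_fin] at hle
      lia
    simp only [mem_insert, mem_singleton, not_or] at hk
    obtain ⟨l, hl, a, b, hab⟩ := hF k
    simp only [mem_biUnion, mem_filter, mem_univ, true_and, good]
    refine ⟨((k, a), (l, b), (i₀, c), (j, d)), ⟨?_, ?_, ?_, ?_⟩, hab, hcd⟩
    · exact fun h => hl (congrArg Prod.fst h).symm
    · exact fun h => hj (congrArg Prod.fst h).symm
    · exact fun h => hk.1 (congrArg Prod.fst h)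
    · exact fun h => hk.2 (congrArg Prod.fst h)
  refine (card_le_card hsub).trans ((card_biUnion_le_card_mul _ _ (n ^ (K * m - 2)) ?_).trans ?_)
  · intro t ht
    simp only [mem_filter, mem_univ, true_and, good] at ht
    simpa [I] using
      card_filter_eq_and_eq_le (α := Fin n) ht.1 ht.2.1 ht.2.2.1 ht.2.2.2
  · gcongr
    refine (card_le_univ _).trans (le_of_eq ?_)
    simp [I]
    ring

/-- A sum of bounded centred functions, each depending only on the coordinates in the range of its
index map, has `K`-th moment `O(n ^ (K * m - 2))` for `K ≥ 3`. -/
lemma abs_expectUnif_sum_pow_le {K : ℕ} (hK : 3 ≤ K) {m n : ℕ}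
    {Z : (Fin m → Fin n) → (Fin n → Bool) → ℝ} (hdep : ∀ π, DependsOn (Z π) (Set.range π))
    (hmean : ∀ π, expectUnif n (Z π) = 0) (hbound : ∀ π y, |Z π y| ≤ 1) :
    |expectUnif n (fun y => (∑ π, Z π y) ^ K)| ≤ ((K * m : ℕ) : ℝ) ^ 4 * (n : ℝ) ^ (K * m - 2) := by
  classical
  let curried (F : Fin K × Fin m → Fin n) (i : Fin K) : Fin m → Fin n := fun a => F (i, a)
  have hexpand : expectUnif n (fun y => (∑ π, Z π y) ^ K) =
      ∑ F : Fin K × Fin m → Fin n, expectUnif n (fun y => ∏ i, Z (curried F i) y) := by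
    rw [← expectUnif_sum]
    congr 1
    ext y
    rw [Fintype.sum_pow]
    exact (Equiv.sum_comp (Equiv.curry (Fin K) (Fin m) (Fin n))
      fun p => ∏ i, Z (p i) y).symm
  have hzero : ∀ F : Fin K × Fin m → Fin n, ¬ Entangled F →
      expectUnif n (fun y => ∏ i, Z (curried F i) y) = 0 := by
    intro F hF
    simp only [Entangled, not_forall, not_exists, not_and] at hF
    obtain ⟨i, hi⟩ := hF
    have hrest : DependsOn (fun y => ∏ j ∈ univ.erase i, Z (curried F j) y)
        (Set.range (curried F i))ᶜ := by
      intro y y' h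
      refine prod_congr rfl fun j hj => hdep _ ?_
      rintro _ ⟨b, rfl⟩
      refine h _ ?_
      rintro ⟨a, ha⟩
      exact hi j (ne_of_mem_erase hj) a b ha
    have := expectUnif_mul_of_dependsOn (hdep (curried F i)) hrest
    rw [hmean, zero_mul] at this
    rw [← this]
    congr 1
    ext y
    exact (mul_prod_erase univ (fun j => Z (curried F j) y) (mem_univ i)).symm
  rw [hexpand, ← sum_filter_add_sum_filter_not univ Entangled, sum_eq_zero (s := filter _ _)
    (f := fun F => expectUnif n (fun y => ∏ i, Z (curried F i) y))
    (fun F hF => hzero F (mem_filter.1 hF).2), add_zero]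
  calc _ ≤ ∑ F : Fin K × Fin m → Fin n with Entangled F,
        |expectUnif n (fun y => ∏ i, Z (curried F i) y)| := abs_sum_le_sum_abs _ _
    _ ≤ ∑ F : Fin K × Fin m → Fin n with Entangled F, (1 : ℝ) := by
        gcongr with F
        refine abs_expectUnif_le n fun y => ?_
        rw [abs_prod]
        exact prod_le_one (fun _ _ => abs_nonneg _) fun _ _ => hbound _ _
    _ ≤ _ := by
        rw [sum_const, nsmul_eq_mul, mul_one]
        exact_mod_cast card_entangled_le hK m n

open Classical in
/-- Indicator that `π` embeds `x` in `y`. -/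
noncomputable def embedIndicator {m n : ℕ} (x : Fin m → Bool) (π : Fin m → Fin n)
    (y : Fin n → Bool) : ℝ :=
  if StrictMono π ∧ ∀ j, y (π j) = x j then 1 else 0

lemma omega_eq_sum {m n : ℕ} (x : Fin m → Bool) (y : Fin n → Bool) :
    (omega x y : ℝ) = ∑ π, embedIndicator x π y := by
  classical
  simp only [omega, embedIndicator, sum_boole, Nat.card_eq_fintype_card, Fintype.card_subtype]

lemma abs_central_moment_le {K : ℕ} (hK : 3 ≤ K) {m : ℕ} (x : Fin m → Bool) (n : ℕ) :
    |expectUnif n (fun y => ((omega x y : ℝ) - expectUnif n (fun y' => (omega x y' : ℝ))) ^ K)| ≤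
      ((K * m : ℕ) : ℝ) ^ 4 * (n : ℝ) ^ (K * m - 2) := by
  simp only [omega_eq_sum, expectUnif_sum, ← sum_sub_distrib]
  have hnonneg : ∀ π y, 0 ≤ embedIndicator (n := n) x π y := fun π y => by
    unfold embedIndicator; split_ifs <;> norm_num
  have hle : ∀ π y, embedIndicator (n := n) x π y ≤ 1 := fun π y => by
    unfold embedIndicator; split_ifs <;> norm_num
  refine abs_expectUnif_sum_pow_le hK (fun π y y' h => ?_) (fun π => ?_) (fun π y => ?_)
  · have hmatch : ∀ j, y (π j) = y' (π j) := fun j => h _ ⟨j, rfl⟩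
    simp only [embedIndicator, hmatch]
  · simp only [sub_eq_add_neg]
    rw [expectUnif_add, expectUnif_const, add_neg_cancel]
  · have h0 : 0 ≤ expectUnif n (embedIndicator x π) :=
      (expectUnif_const n 0).symm.le.trans (expectUnif_mono n (hnonneg π))
    have h1 : expectUnif n (embedIndicator x π) ≤ 1 :=
      (expectUnif_mono n (hle π)).trans (expectUnif_const n 1).le
    rw [abs_le]
    constructor <;> linarith [hnonneg π y, hle π y]

lemma central_moment_isBigO {K : ℕ} (hK : 3 ≤ K) {m : ℕ} (x : Fin m → Bool) :
    (fun n : ℕ => expectUnif n (fun y =>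
        ((omega x y : ℝ) - expectUnif n (fun y' => (omega x y' : ℝ))) ^ K))
      =O[atTop] fun n : ℕ => (n : ℝ) ^ (K * m - 2) := by
  refine IsBigO.of_bound (((K * m : ℕ) : ℝ) ^ 4) (Eventually.of_forall fun n => ?_)
  rw [Real.norm_eq_abs, Real.norm_of_nonneg (by positivity)]
  exact abs_central_moment_le hK x n

/-- The fourth central moment of `Ω_n(x)` is `O(n^{4m−2})` and the third central moment
is `o(n^{3m−3/2})` as `n → ∞`. -/
theorem central_moment_bounds (m : ℕ) (hm : 0 < m) (x : Fin m → Bool) :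
    ((fun n : ℕ => expectUnif n (fun y =>
        ((omega x y : ℝ) - expectUnif n (fun y' => (omega x y' : ℝ))) ^ 4))
      =O[atTop] fun n : ℕ => (n : ℝ) ^ (4 * m - 2)) ∧
    ((fun n : ℕ => expectUnif n (fun y =>
        ((omega x y : ℝ) - expectUnif n (fun y' => (omega x y' : ℝ))) ^ 3))
      =o[atTop] fun n : ℕ => (n : ℝ) ^ ((3 * (m : ℝ)) - 3 / 2)) := by
  refine ⟨central_moment_isBigO (by norm_num) x,
    (central_moment_isBigO le_rfl x).trans_isLittleO ?_⟩
  have hexp : (3 * m - 2 : ℕ) < 3 * (m : ℝ) - 3 / 2 := by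
    rw [Nat.cast_sub (by lia)]
    push_cast
    linarith
  refine ((isLittleO_of_tendsto' ?_ ?_ :
    (fun t : ℝ => t ^ (3 * m - 2)) =o[atTop] fun t => t ^ (3 * (m : ℝ) - 3 / 2))).comp_tendsto
      tendsto_natCast_atTop_atTop
  · filter_upwards [eventually_gt_atTop 0] with t ht h
    exact absurd h (Real.rpow_pos_of_pos ht _).ne'
  · refine (tendsto_rpow_neg_atTop (sub_pos.2 hexp)).congr' ?_
    filter_upwards [eventually_gt_atTop 0] with t ht
    rw [neg_sub, Real.rpow_sub ht, Real.rpow_natCast]
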